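/- For any pair of convex bodies K, L in ℝ^n and any θ with 0 ≤ θ ≤ (3/4)^n, one has |K +_θ L|^(1/n) ≥ (1 − (4/3 − (1/6)·binom(2n,n)^(1/n))·θ^(1/n))·(|K|^(1/n) + |L|^(1/n)). -/

import Mathlib

open MeasureTheory Set Pointwise

variable {n : ℕ}

/-- The generalized covariogram `z ↦ |K ∩ (z - L)|`. -/
noncomputable def covar (K L : Set (EuclideanSpace ℝ (Fin n)))
    (z : EuclideanSpace ℝ (Fin n)) : ℝ :=
  (volume {x | x ∈ K ∧ z - x ∈ L}).toReal

/-- `M(K,L) = max_z |K ∩ (z - L)|`. -/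
noncomputable def Mmax (K L : Set (EuclideanSpace ℝ (Fin n))) : ℝ :=
  ⨆ z, covar K L z

/-- The θ-convolution body. -/
noncomputable def thetaConv (K L : Set (EuclideanSpace ℝ (Fin n))) (θ : ℝ) :
    Set (EuclideanSpace ℝ (Fin n)) :=
  {z ∈ K + L | θ * Mmax K L ≤ covar K L z}

/-- A convex body: compact, convex, with nonempty interior. -/
def IsConvexBody (K : Set (EuclideanSpace ℝ (Fin n))) : Prop :=
  IsCompact K ∧ Convex ℝ K ∧ (interior K).Nonempty


open scoped ENNReal

theorem bm_one_dim {A B C : Set ℝ} (hA : MeasurableSet A) (hB : MeasurableSet B)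
    (hA0 : A.Nonempty) (hB0 : B.Nonempty) (h : ∀ a ∈ A, ∀ b ∈ B, a + b ∈ C) :
    volume A + volume B ≤ volume C := by
  have key : ∀ K1 ⊆ A, IsCompact K1 → ∀ K2 ⊆ B, IsCompact K2 →
      volume K1 + volume K2 ≤ volume C := by
    intro K1 h1 c1 K2 h2 c2
    obtain ⟨a0, ha0⟩ := hA0
    obtain ⟨b0, hb0⟩ := hB0
    rcases K1.eq_empty_or_nonempty with rfl | n1
    · rw [measure_empty, zero_add]
      calc volume K2 = volume ((fun x => a0 + x) '' K2) := by
            rw [image_add_left, measure_preimage_add]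
        _ ≤ _ := measure_mono (by rintro _ ⟨x, hx, rfl⟩; exact h _ ha0 _ (h2 hx))
    rcases K2.eq_empty_or_nonempty with rfl | n2
    · rw [measure_empty, add_zero]
      calc volume K1 = volume ((fun x => x + b0) '' K1) := by
            rw [image_add_right, measure_preimage_add_right]
        _ ≤ _ := measure_mono (by rintro _ ⟨x, hx, rfl⟩; exact h _ (h1 hx) _ hb0)
    obtain ⟨a, ha, hamax⟩ := c1.exists_isGreatest n1
    obtain ⟨b, hb, hbmin⟩ := c2.exists_isLeast n2
    have e1 : volume K1 = volume ((fun x => x + b) '' K1) := by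
      rw [image_add_right, measure_preimage_add_right]
    have e2 : volume K2 = volume ((fun x => a + x) '' K2) := by
      rw [image_add_left, measure_preimage_add]
    have hd : AEDisjoint volume ((fun x => x + b) '' K1) ((fun x => a + x) '' K2) := by
      refine measure_mono_null (t := {a + b}) ?_ (by simp)
      rintro _ ⟨⟨x, hx, rfl⟩, ⟨y, hy, hxy⟩⟩
      have := hamax hx
      have := hbmin hy
      simp only [mem_singleton_iff] at *
      linarith
    have m2 : MeasurableSet ((fun x => a + x) '' K2) :=
      (c2.image (by fun_prop)).measurableSet
    rw [e1, e2, ← measure_union₀ m2.nullMeasurableSet hd]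
    apply measure_mono
    rintro _ (⟨x, hx, rfl⟩ | ⟨x, hx, rfl⟩)
    · exact h _ (h1 hx) _ (h2 hb)
    · exact h _ (h1 ha) _ (h2 hx)
  rw [hA.measure_eq_iSup_isCompact, hB.measure_eq_iSup_isCompact]
  have hne : ∀ S : Set ℝ, Nonempty {K : Set ℝ // K ⊆ S ∧ IsCompact K} :=
    fun S => ⟨∅, empty_subset _, isCompact_empty⟩
  have e : ∀ S : Set ℝ, (⨆ K, ⨆ (_ : K ⊆ S), ⨆ (_ : IsCompact K), volume K)
      = ⨆ K : {K : Set ℝ // K ⊆ S ∧ IsCompact K}, volume K.1 := by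
    intro S
    rw [iSup_subtype]
    simp only [iSup_and]
  rw [e A, e B]
  have := hne A
  have := hne B
  rw [ENNReal.iSup_add]
  refine iSup_le fun K1 => ?_
  rw [ENNReal.add_iSup]
  exact iSup_le fun K2 => key _ K1.2.1 K1.2.2 _ K2.2.1 K2.2.2

theorem bm_one_dim_lam {A B C : Set ℝ} (hA : MeasurableSet A) (hB : MeasurableSet B)
    (hA0 : A.Nonempty) (hB0 : B.Nonempty) {p q : ℝ} (hp : 0 < p) (hq : 0 < q)
    (h : ∀ a ∈ A, ∀ b ∈ B, p * a + q * b ∈ C) :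
    ENNReal.ofReal p * volume A + ENNReal.ofReal q * volume B ≤ volume C := by
  have := bm_one_dim (A := p • A) (B := q • B) (C := C) (hA.const_smul₀ p) (hB.const_smul₀ q)
    hA0.smul_set hB0.smul_set (by
      rintro _ ⟨a, ha, rfl⟩ _ ⟨b, hb, rfl⟩
      exact h a ha b hb)
  simpa [Measure.addHaar_smul, abs_of_pos hp, abs_of_pos hq] using this

theorem pl_one_norm {f g h : ℝ → ℝ} (hf : Measurable f) (hg : Measurable g) (hh : Measurable h)
    (f0 : ∀ x, 0 ≤ f x) (g0 : ∀ x, 0 ≤ g x) (h0 : ∀ x, 0 ≤ h x)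
    (f1 : ∀ x, f x ≤ 1) (g1 : ∀ x, g x ≤ 1)
    (fs : ∀ t < 1, ∃ x, t < f x) (gs : ∀ t < 1, ∃ x, t < g x)
    {p q : ℝ} (hp : 0 < p) (hq : 0 < q)
    (H : ∀ t x y, 0 < t → t < f x → t < g y → t < h (p * x + q * y)) :
    ENNReal.ofReal p * (∫⁻ x, ENNReal.ofReal (f x)) + ENNReal.ofReal q * (∫⁻ x, ENNReal.ofReal (g x))
      ≤ ∫⁻ x, ENNReal.ofReal (h x) := by
  have an : ∀ u : ℝ → ℝ, Measurable u → Measurable fun t => volume {a | t < u a} := by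
    intro u _
    apply Antitone.measurable
    intro s t hst
    exact measure_mono fun a ha => lt_of_le_of_lt hst ha
  rw [lintegral_eq_lintegral_meas_lt _ (ae_of_all _ f0) hf.aemeasurable,
    lintegral_eq_lintegral_meas_lt _ (ae_of_all _ g0) hg.aemeasurable,
    lintegral_eq_lintegral_meas_lt _ (ae_of_all _ h0) hh.aemeasurable,
    ← lintegral_const_mul _ (an f hf), ← lintegral_const_mul _ (an g hg),
    ← lintegral_add_left ((an f hf).const_mul _)]
  refine setLIntegral_mono (an h hh) fun t ht => ?_
  rcases lt_or_ge t 1 with h1 | h1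
  · exact bm_one_dim_lam (hf measurableSet_Ioi) (hg measurableSet_Ioi) (fs t h1) (gs t h1) hp hq
      fun a ha b hb => H t a b ht ha hb
  · have e1 : {a | t < f a} = ∅ := by
      ext a; simpa using (f1 a).trans h1
    have e2 : {a | t < g a} = ∅ := by
      ext a; simpa using (g1 a).trans h1
    simp [e1, e2]

theorem ennreal_amgm {p q : ℝ} (hp : 0 < p) (hq : 0 < q) (hpq : p + q = 1) (a b : ℝ≥0∞) :
    a ^ p * b ^ q ≤ ENNReal.ofReal p * a + ENNReal.ofReal q * b := by
  by_cases ha : a = ⊤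
  · subst ha
    simp [ENNReal.mul_top, hp]
  by_cases hb : b = ⊤
  · subst hb
    simp [ENNReal.mul_top, hq]
  lift a to NNReal using ha
  lift b to NNReal using hb
  have := NNReal.geom_mean_le_arith_mean2_weighted p.toNNReal q.toNNReal a b
    (by rw [← Real.toNNReal_add hp.le hq.le, hpq]; simp)
  rw [← ENNReal.coe_rpow_of_nonneg _ hp.le, ← ENNReal.coe_rpow_of_nonneg _ hq.le]
  simp only [Real.coe_toNNReal _ hp.le, Real.coe_toNNReal _ hq.le] at this
  unfold ENNReal.ofReal
  exact_mod_cast this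

theorem pl_one_bdd {f g h : ℝ → ℝ≥0∞} (hf : Measurable f) (hg : Measurable g) (hh : Measurable h)
    (fb : (⨆ x, f x) ≠ ⊤) (gb : (⨆ x, g x) ≠ ⊤)
    {p q : ℝ} (hp : 0 < p) (hq : 0 < q) (hpq : p + q = 1)
    (H : ∀ x y, f x ^ p * g y ^ q ≤ h (p * x + q * y)) :
    (∫⁻ x, f x) ^ p * (∫⁻ x, g x) ^ q ≤ ∫⁻ x, h x := by
  set A := ⨆ x, f x with hA
  set B := ⨆ x, g x with hB
  by_cases hA0 : A = 0
  · have : ∀ x, f x = 0 := fun x => by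
      have := le_iSup f x
      rw [← hA, hA0] at this
      simpa using this
    simp [this, hp]
  by_cases hB0 : B = 0
  · have : ∀ x, g x = 0 := fun x => by
      have := le_iSup g x
      rw [← hB, hB0] at this
      simpa using this
    simp [this, hq]
  have hfA : ∀ x, f x / A ≤ 1 := fun x => ENNReal.div_le_of_le_mul (by simpa using le_iSup f x)
  have hgB : ∀ x, g x / B ≤ 1 := fun x => ENNReal.div_le_of_le_mul (by simpa using le_iSup g x)
  set c := A ^ p * B ^ q with hc
  have c0 : c ≠ 0 := by
    simp only [hc, ne_eq, mul_eq_zero, ENNReal.rpow_eq_zero_iff, not_or]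
    refine ⟨?_, ?_⟩ <;> simp [hA0, hB0, fb, gb]
  have ct : c ≠ ⊤ := ENNReal.mul_ne_top (ENNReal.rpow_ne_top_of_nonneg hp.le fb)
    (ENNReal.rpow_ne_top_of_nonneg hq.le gb)
  have hhc : ∀ x, min (h x) c / c ≤ 1 := fun x => ENNReal.div_le_of_le_mul (by simp)
  have ne1 : ∀ {z : ℝ≥0∞}, z ≤ 1 → z ≠ ⊤ := fun hz => (hz.trans_lt ENNReal.one_lt_top).ne
  have sup : ∀ (u : ℝ → ℝ≥0∞) (S : ℝ≥0∞), S = (⨆ x, u x) → S ≠ 0 → S ≠ ⊤ → (∀ x, u x / S ≤ 1) →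
      ∀ t < (1:ℝ), ∃ x, t < (u x / S).toReal := by
    intro u S hS S0 St hu t ht
    rcases lt_or_ge t 0 with ht0 | ht0
    · exact ⟨0, ht0.trans_le ENNReal.toReal_nonneg⟩
    have : ENNReal.ofReal t * S < S := by
      conv_rhs => rw [← one_mul S]
      exact ENNReal.mul_lt_mul_left S0 St (by simpa using ht)
    conv_rhs at this => rw [hS]
    obtain ⟨x, hx⟩ := lt_iSup_iff.1 this
    refine ⟨x, ?_⟩
    rw [← ENNReal.ofReal_lt_iff_lt_toReal ht0 (ne1 (hu x))]
    rwa [ENNReal.lt_div_iff_mul_lt (Or.inl S0) (Or.inl St)]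
  have main := pl_one_norm (f := fun x => (f x / A).toReal) (g := fun x => (g x / B).toReal)
    (h := fun x => (min (h x) c / c).toReal) (hf.div_const _).ennreal_toReal
    (hg.div_const _).ennreal_toReal ((hh.min measurable_const).div_const _).ennreal_toReal
    (fun _ => ENNReal.toReal_nonneg) (fun _ => ENNReal.toReal_nonneg)
    (fun _ => ENNReal.toReal_nonneg)
    (fun x => by simpa using ENNReal.toReal_mono (by simp) (hfA x))
    (fun x => by simpa using ENNReal.toReal_mono (by simp) (hgB x))
    (sup f A hA hA0 fb hfA) (sup g B hB hB0 gb hgB) hp hq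
    (by
      intro t x y ht hx hy
      rw [← ENNReal.ofReal_lt_iff_lt_toReal ht.le (ne1 (hfA x)),
        ENNReal.lt_div_iff_mul_lt (Or.inl hA0) (Or.inl fb)] at hx
      rw [← ENNReal.ofReal_lt_iff_lt_toReal ht.le (ne1 (hgB y)),
        ENNReal.lt_div_iff_mul_lt (Or.inl hB0) (Or.inl gb)] at hy
      rw [← ENNReal.ofReal_lt_iff_lt_toReal ht.le (ne1 (hhc _)),
        ENNReal.lt_div_iff_mul_lt (Or.inl c0) (Or.inl ct)]
      have ht1 : ENNReal.ofReal t * c = (ENNReal.ofReal t * A) ^ p * (ENNReal.ofReal t * B) ^ q := by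
        rw [ENNReal.mul_rpow_of_nonneg _ _ hp.le, ENNReal.mul_rpow_of_nonneg _ _ hq.le, hc]
        have : ENNReal.ofReal t = ENNReal.ofReal t ^ p * ENNReal.ofReal t ^ q := by
          rw [← ENNReal.rpow_add _ _ (by simpa using ht) (by simp), hpq, ENNReal.rpow_one]
        conv_lhs => rw [this]
        ring
      have l1 : ENNReal.ofReal t * c < f x ^ p * g y ^ q := by
        rw [ht1]
        exact ENNReal.mul_lt_mul (ENNReal.rpow_lt_rpow hx hp) (ENNReal.rpow_lt_rpow hy hq)
      refine lt_min (l1.trans_le (H x y)) (l1.trans_le ?_)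
      exact mul_le_mul' (ENNReal.rpow_le_rpow (le_iSup f x) hp.le)
        (ENNReal.rpow_le_rpow (le_iSup g y) hq.le))
  simp only [ENNReal.ofReal_toReal (ne1 (hfA _)), ENNReal.ofReal_toReal (ne1 (hgB _)),
    ENNReal.ofReal_toReal (ne1 (hhc _))] at main
  simp only [div_eq_mul_inv] at main
  rw [lintegral_mul_const _ hf, lintegral_mul_const _ hg,
    lintegral_mul_const _ (hh.min measurable_const)] at main
  have m2 := (ennreal_amgm hp hq hpq _ _).trans main
  rw [ENNReal.mul_rpow_of_nonneg _ _ hp.le, ENNReal.mul_rpow_of_nonneg _ _ hq.le] at m2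
  have m3 := mul_le_mul_left m2 c
  have e1 : (∫⁻ x, f x) ^ p * A⁻¹ ^ p * ((∫⁻ x, g x) ^ q * B⁻¹ ^ q) * c
      = (∫⁻ x, f x) ^ p * (∫⁻ x, g x) ^ q := by
    have a1 : A⁻¹ ^ p * A ^ p = 1 := by
      rw [← ENNReal.mul_rpow_of_nonneg _ _ hp.le, ENNReal.inv_mul_cancel hA0 fb, ENNReal.one_rpow]
    have a2 : B⁻¹ ^ q * B ^ q = 1 := by
      rw [← ENNReal.mul_rpow_of_nonneg _ _ hq.le, ENNReal.inv_mul_cancel hB0 gb, ENNReal.one_rpow]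
    calc _ = (∫⁻ x, f x) ^ p * (∫⁻ x, g x) ^ q * (A⁻¹ ^ p * A ^ p) * (B⁻¹ ^ q * B ^ q) := by
          rw [hc]; ring
      _ = _ := by rw [a1, a2, mul_one, mul_one]
  rw [e1, mul_assoc, ENNReal.inv_mul_cancel c0 ct, mul_one] at m3
  exact m3.trans (lintegral_mono fun x => min_le_left _ _)

theorem pl_one {f g h : ℝ → ℝ≥0∞} (hf : Measurable f) (hg : Measurable g) (hh : Measurable h)
    {p q : ℝ} (hp : 0 < p) (hq : 0 < q) (hpq : p + q = 1)
    (H : ∀ x y, f x ^ p * g y ^ q ≤ h (p * x + q * y)) :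
    (∫⁻ x, f x) ^ p * (∫⁻ x, g x) ^ q ≤ ∫⁻ x, h x := by
  have tr : ∀ u : ℝ → ℝ≥0∞, Measurable u →
      Filter.Tendsto (fun k : ℕ => ∫⁻ x, min (u x) k) Filter.atTop (nhds (∫⁻ x, u x)) := by
    intro u hu
    refine lintegral_tendsto_of_tendsto_of_monotone (fun k => (hu.min measurable_const).aemeasurable)
      (ae_of_all _ fun x k l hkl => min_le_min le_rfl (by exact_mod_cast hkl))
      (ae_of_all _ fun x => ?_)
    have := (tendsto_const_nhds (x := u x)).min ENNReal.tendsto_nat_nhds_top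
    simpa using this
  have fin : ∀ k : ℕ, (∫⁻ x, min (f x) k) ^ p * (∫⁻ x, min (g x) k) ^ q ≤ ∫⁻ x, h x := by
    intro k
    refine pl_one_bdd (hf.min measurable_const) (hg.min measurable_const) hh ?_ ?_ hp hq hpq ?_
    · exact ((iSup_le fun x => min_le_right _ _).trans_lt (ENNReal.natCast_lt_top k)).ne
    · exact ((iSup_le fun x => min_le_right _ _).trans_lt (ENNReal.natCast_lt_top k)).ne
    · intro x y
      exact (mul_le_mul' (ENNReal.rpow_le_rpow (min_le_left _ _) hp.le)
        (ENNReal.rpow_le_rpow (min_le_left _ _) hq.le)).trans (H x y)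
  -- iterate limits through suprema
  have mono : ∀ u : ℝ → ℝ≥0∞, Monotone fun k : ℕ => ∫⁻ x, min (u x) k := fun u k l hkl =>
    lintegral_mono fun x => min_le_min le_rfl (by exact_mod_cast hkl)
  by_cases hF : (∫⁻ x, f x) = 0
  · simp [hF, hp]
  by_cases hG : (∫⁻ x, g x) = 0
  · simp [hG, hq]
  have t1 := ((ENNReal.continuous_rpow_const (y := p)).tendsto _).comp (tr f hf)
  have t2 := ((ENNReal.continuous_rpow_const (y := q)).tendsto _).comp (tr g hg)
  have t3 := ENNReal.Tendsto.mul t1 (Or.inl (by simp [hF, ENNReal.rpow_eq_zero_iff, hp, hp.not_gt])) t2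
    (Or.inl (by simp [hG, ENNReal.rpow_eq_zero_iff, hq, hq.not_gt]))
  exact le_of_tendsto' t3 fin

theorem pl_pi {p q : ℝ} (hp : 0 < p) (hq : 0 < q) (hpq : p + q = 1) (n : ℕ) :
    ∀ {f g h : (Fin n → ℝ) → ℝ≥0∞} (_ : Measurable f) (_ : Measurable g) (_ : Measurable h)
    (_ : ∀ x y, f x ^ p * g y ^ q ≤ h (p • x + q • y)),
    (∫⁻ x, f x) ^ p * (∫⁻ x, g x) ^ q ≤ ∫⁻ x, h x := by
  induction n with
  | zero =>
    intro f g h hf hg hh H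
    have := H default default
    rw [Measure.volume_pi_eq_dirac default]
    simp only [lintegral_dirac]
    convert this
  | succ n ih =>
    intro f g h hf hg hh H
    set e := (MeasurableEquiv.piFinSuccAbove (fun _ : Fin (n+1) => ℝ) 0).symm with he
    have hvp : MeasurePreserving e :=
      (volume_preserving_piFinSuccAbove (fun _ : Fin (n + 1) => ℝ) 0).symm _
    have fub : ∀ u : (Fin (n+1) → ℝ) → ℝ≥0∞, Measurable u →
        (∫⁻ x, u x) = ∫⁻ s : ℝ, ∫⁻ y : Fin n → ℝ, u (e (s, y)) := by
      intro u hu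
      rw [← hvp.lintegral_comp hu, Measure.volume_eq_prod]
      exact lintegral_prod _ (hu.comp e.measurable).aemeasurable
    rw [fub f hf, fub g hg, fub h hh]
    have ms : ∀ u : (Fin (n+1) → ℝ) → ℝ≥0∞, Measurable u →
        Measurable fun s : ℝ => ∫⁻ y : Fin n → ℝ, u (e (s, y)) := fun u hu =>
      (hu.comp e.measurable).lintegral_prod_right'
    refine pl_one (ms f hf) (ms g hg) (ms h hh) hp hq hpq ?_
    intro s t
    have mm : ∀ (u : (Fin (n+1) → ℝ) → ℝ≥0∞) (s : ℝ), Measurable u →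
        Measurable fun y : Fin n → ℝ => u (e (s, y)) := fun u s hu =>
      (hu.comp e.measurable).comp measurable_prodMk_left
    refine ih (mm f s hf) (mm g t hg) (mm h _ hh) ?_
    intro x y
    convert H (e (s, x)) (e (t, y)) using 2
    ext i
    refine Fin.cases ?_ (fun j => ?_) i
    · simp [he, MeasurableEquiv.piFinSuccAbove]
    · simp [he, MeasurableEquiv.piFinSuccAbove]

theorem pl_sets {p q : ℝ} (hp : 0 < p) (hq : 0 < q) (hpq : p + q = 1)
    {A B C : Set (EuclideanSpace ℝ (Fin n))} (hA : MeasurableSet A) (hB : MeasurableSet B)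
    (hC : MeasurableSet C) (h : ∀ a ∈ A, ∀ b ∈ B, p • a + q • b ∈ C) :
    volume A ^ p * volume B ^ q ≤ volume C := by
  have mp := PiLp.volume_preserving_toLp (Fin n)
  have vol : ∀ S : Set (EuclideanSpace ℝ (Fin n)), MeasurableSet S →
      volume S = ∫⁻ x : Fin n → ℝ, (WithLp.toLp 2 ⁻¹' S).indicator 1 x := by
    intro S hS
    rw [lintegral_indicator_one (mp.measurable hS), mp.measure_preimage hS.nullMeasurableSet]
  rw [vol A hA, vol B hB, vol C hC]
  refine pl_pi hp hq hpq n (measurable_one.indicator (mp.measurable hA))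
    (measurable_one.indicator (mp.measurable hB)) (measurable_one.indicator (mp.measurable hC)) ?_
  intro x y
  by_cases hx : WithLp.toLp 2 x ∈ A
  · by_cases hy : WithLp.toLp 2 y ∈ B
    · have := h _ hx _ hy
      have hz : WithLp.toLp 2 (p • x + q • y) ∈ C := by simpa using this
      rw [indicator_of_mem (by exact hx), indicator_of_mem (by exact hy),
        indicator_of_mem (by exact hz)]
      simp
    · rw [indicator_of_notMem (a := y) (by exact hy)]
      simp [hq]
  · rw [indicator_of_notMem (a := x) (by exact hx)]
    simp [hp]

/-- the volume radius `|A|^(1/n)` -/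
noncomputable def vrad (A : Set (EuclideanSpace ℝ (Fin n))) : ℝ :=
  (volume A).toReal ^ ((1:ℝ)/n)

theorem vrad_nonneg (A : Set (EuclideanSpace ℝ (Fin n))) : 0 ≤ vrad A :=
  Real.rpow_nonneg ENNReal.toReal_nonneg _

theorem vrad_pow (hn : 0 < n) (A : Set (EuclideanSpace ℝ (Fin n))) :
    vrad A ^ n = (volume A).toReal := by
  unfold vrad
  rw [one_div, Real.rpow_inv_natCast_pow ENNReal.toReal_nonneg hn.ne']

theorem vrad_mono {A B : Set (EuclideanSpace ℝ (Fin n))} (h : volume A ≤ volume B)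
    (hB : volume B ≠ ⊤) : vrad A ≤ vrad B :=
  Real.rpow_le_rpow ENNReal.toReal_nonneg (ENNReal.toReal_mono hB h) (by positivity)

theorem vrad_smul (hn : 0 < n) {c : ℝ} (hc : 0 ≤ c) (A : Set (EuclideanSpace ℝ (Fin n))) :
    vrad (c • A) = c * vrad A := by
  unfold vrad
  rw [Measure.addHaar_smul, ENNReal.toReal_mul, Real.mul_rpow ENNReal.toReal_nonneg
    ENNReal.toReal_nonneg]
  congr 1
  rw [ENNReal.toReal_ofReal (abs_nonneg _), finrank_euclideanSpace_fin, abs_of_nonneg (by positivity),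
    one_div, Real.pow_rpow_inv_natCast hc hn.ne']

theorem bm_add (hn : 0 < n) {A B C : Set (EuclideanSpace ℝ (Fin n))} (hA : MeasurableSet A)
    (hB : MeasurableSet B) (hC : MeasurableSet C) (hA0 : A.Nonempty) (hB0 : B.Nonempty)
    (hCt : volume C ≠ ⊤) (h : ∀ a ∈ A, ∀ b ∈ B, a + b ∈ C) : vrad A + vrad B ≤ vrad C := by
  have AC : volume A ≤ volume C := by
    obtain ⟨b, hb⟩ := hB0
    calc volume A = volume ((fun x => x + b) '' A) := by
            rw [image_add_right, measure_preimage_add_right]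
      _ ≤ _ := measure_mono (by rintro _ ⟨x, hx, rfl⟩; exact h _ hx _ hb)
  have BC : volume B ≤ volume C := by
    obtain ⟨a, ha⟩ := hA0
    calc volume B = volume ((fun x => a + x) '' B) := by
            rw [image_add_left, measure_preimage_add]
      _ ≤ _ := measure_mono (by rintro _ ⟨x, hx, rfl⟩; exact h _ ha _ hx)
  rcases (vrad_nonneg A).eq_or_lt with ha | ha
  · rw [← ha, zero_add]; exact vrad_mono BC hCt
  rcases (vrad_nonneg B).eq_or_lt with hb | hb
  · rw [← hb, add_zero]; exact vrad_mono AC hCt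
  have one : ∀ S : Set (EuclideanSpace ℝ (Fin n)), 0 < vrad S → volume ((vrad S)⁻¹ • S) = 1 := by
    intro S hS
    have h1 : vrad ((vrad S)⁻¹ • S) = 1 := by
      rw [vrad_smul hn (by positivity), inv_mul_cancel₀ hS.ne']
    have h2 := vrad_pow hn ((vrad S)⁻¹ • S)
    rw [h1, one_pow, eq_comm, ENNReal.toReal_eq_one_iff] at h2
    exact h2
  have hs : 0 < vrad A + vrad B := by positivity
  have := pl_sets (p := vrad A / (vrad A + vrad B)) (q := vrad B / (vrad A + vrad B))
    (by positivity) (by positivity) (by field_simp)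
    (hA.const_smul₀ (vrad A)⁻¹) (hB.const_smul₀ (vrad B)⁻¹) (hC.const_smul₀ (vrad A + vrad B)⁻¹)
    (by
      rintro _ ⟨a, ha', rfl⟩ _ ⟨b, hb', rfl⟩
      refine ⟨a + b, h a ha' b hb', ?_⟩
      simp only [smul_smul, smul_add]
      congr 2 <;> field_simp)
  rw [one A ha, one B hb, ENNReal.one_rpow, ENNReal.one_rpow, one_mul] at this
  have hfin : volume ((vrad A + vrad B)⁻¹ • C) ≠ ⊤ := by
    rw [Measure.addHaar_smul]
    exact ENNReal.mul_ne_top ENNReal.ofReal_ne_top hCt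
  have h3 := ENNReal.toReal_mono hfin this
  rw [← vrad_pow hn, vrad_smul hn (by positivity), ENNReal.toReal_one] at h3
  have h4 : 1 ≤ (vrad A + vrad B)⁻¹ * vrad C := by
    by_contra hlt
    push Not at hlt
    exact absurd h3 (not_le.2 (pow_lt_one₀ (mul_nonneg (by positivity) (vrad_nonneg C)) hlt hn.ne'))
  rw [inv_mul_eq_div, le_div_iff₀ hs, one_mul] at h4
  exact h4

theorem bm (hn : 0 < n) {A B C : Set (EuclideanSpace ℝ (Fin n))} (hA : MeasurableSet A)
    (hB : MeasurableSet B) (hC : MeasurableSet C) (hA0 : A.Nonempty) (hB0 : B.Nonempty)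
    (hCt : volume C ≠ ⊤) {p q : ℝ} (hp : 0 ≤ p) (hq : 0 ≤ q)
    (h : ∀ a ∈ A, ∀ b ∈ B, p • a + q • b ∈ C) : p * vrad A + q * vrad B ≤ vrad C := by
  rw [← vrad_smul hn hp, ← vrad_smul hn hq]
  refine bm_add hn (hA.const_smul₀ p) (hB.const_smul₀ q) hC hA0.smul_set hB0.smul_set hCt ?_
  rintro _ ⟨a, ha, rfl⟩ _ ⟨b, hb, rfl⟩
  exact h a ha b hb

theorem beta_int (n : ℕ) : ∀ m : ℕ, ∫ t in (0:ℝ)..1, (1 - t) ^ n * t ^ m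
    = 1 / ((n + m + 1) * (n + m).choose n) := by
  induction n with
  | zero => intro m; simp
  | succ n ih =>
    intro m
    have ibp := intervalIntegral.integral_mul_deriv_eq_deriv_mul (a := 0) (b := 1)
      (u := fun t : ℝ => (1 - t) ^ (n+1)) (v := fun t : ℝ => t ^ (m+1) / (m+1))
      (u' := fun t : ℝ => -((n+1) * (1-t)^n)) (v' := fun t : ℝ => t ^ m)
      (by
        intro x _
        have := ((hasDerivAt_id' x).const_sub 1).fun_pow (n+1)
        convert this using 1
        push_cast
        simp)
      (by
        intro x _
        have := (hasDerivAt_pow (m+1) x).div_const ((m:ℝ)+1)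
        convert this using 1
        push_cast
        field_simp)
      (by apply Continuous.intervalIntegrable; fun_prop)
      (by apply Continuous.intervalIntegrable; fun_prop)
    rw [ibp]
    have : ∀ t : ℝ, -((n+1) * (1-t)^n) * (t ^ (m+1) / (m+1))
        = (-((n+1)/(m+1))) * ((1-t)^n * t^(m+1)) := by
      intro t; field_simp
    simp only [this]
    rw [intervalIntegral.integral_const_mul, ih (m+1)]
    have c : ((n + 1 + m).choose (n+1) : ℝ) * (n+1) = (n + (m+1)).choose n * (m+1) := by
      have := Nat.choose_succ_right_eq (n + 1 + m) n
      rw [show n + 1 + m - n = m + 1 by omega] at this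
      rw [show n + (m+1) = n + 1 + m by ring]
      exact_mod_cast this
    have p1 : (0:ℝ) < ((n + 1 + m).choose (n+1)) := by
      exact_mod_cast Nat.choose_pos (by omega)
    have p2 : (0:ℝ) < ((n + (m+1)).choose n) := by
      exact_mod_cast Nat.choose_pos (by omega)
    simp
    field_simp
    linear_combination (n+m+2:ℝ) * c

theorem beta_theta (hn : 0 < n) : ∫ θ in (0:ℝ)..1, (1 - θ ^ ((1:ℝ)/n)) ^ n
    = 1 / ((2*n).choose n) := by
  have hc : Continuous fun θ : ℝ => (1 - θ ^ ((1:ℝ)/n)) ^ n := by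
    have : Continuous fun θ : ℝ => θ ^ ((1:ℝ)/n) := Real.continuous_rpow_const (by positivity)
    fun_prop
  have := intervalIntegral.integral_comp_mul_deriv (a := 0) (b := 1)
    (f := fun t : ℝ => t ^ n) (f' := fun t : ℝ => n * t ^ (n-1))
    (g := fun θ : ℝ => (1 - θ ^ ((1:ℝ)/n)) ^ n)
    (fun x _ => hasDerivAt_pow n x) (by fun_prop) hc
  simp only [Function.comp] at this
  rw [zero_pow hn.ne', one_pow] at this
  rw [← this]
  have e : ∫ x in (0:ℝ)..1, (1 - (x ^ n) ^ ((1:ℝ)/n)) ^ n * (n * x ^ (n-1))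
      = ∫ x in (0:ℝ)..1, (n:ℝ) * ((1 - x) ^ n * x ^ (n-1)) := by
    apply intervalIntegral.integral_congr
    intro x hx
    rw [uIcc_of_le zero_le_one] at hx
    simp only
    rw [one_div, Real.pow_rpow_inv_natCast hx.1 hn.ne']
    ring
  rw [e, intervalIntegral.integral_const_mul, beta_int]
  obtain ⟨m, rfl⟩ : ∃ m, n = m + 1 := ⟨n-1, by omega⟩
  have c : ((m + 1 + m).choose (m+1) : ℝ) * (2 * m + 2) = (2*(m+1)).choose (m+1) * (m+1) := by
    have := Nat.choose_mul_succ_eq (m + 1 + m) (m+1)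
    rw [show m + 1 + m + 1 - (m + 1) = m + 1 by omega, show m + 1 + m + 1 = 2 * (m+1) by ring] at this
    have := congrArg (Nat.cast (R := ℝ)) this
    push_cast at this
    linear_combination this
  have p1 : (0:ℝ) < ((m + 1 + m).choose (m+1)) := by
    exact_mod_cast Nat.choose_pos (by omega)
  have p2 : (0:ℝ) < ((2*(m+1)).choose (m+1)) := by
    exact_mod_cast Nat.choose_pos (by omega)
  simp only [Nat.add_sub_cancel]
  push_cast
  field_simp
  linear_combination -c

theorem exists_lam {f : ℝ → ℝ}
    (hc : ∀ x y p q : ℝ, 0 ≤ x → x < 1 → 0 ≤ y → y < 1 → 0 ≤ p → 0 ≤ q → p + q = 1 →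
      p * f x + q * f y ≤ f (p * x + q * y))
    (h0 : ∀ x, 0 ≤ f x) (hanti : ∀ x y, 0 ≤ x → x ≤ y → f y ≤ f x) (hf0 : 0 < f 0) :
    0 < f (3/4) ∧ ∃ l : ℝ, 0 ≤ l ∧ l ≤ 1 ∧
      ∀ t, 0 ≤ t → t < 1 → f t ≤ (1 - l) * f (3/4) + l * (4 * f (3/4) * (1 - t)) := by
  set a := f (3/4) with ha
  have key : ∀ t u : ℝ, 0 ≤ t → t < 3/4 → 3/4 < u → u < 1 →
      (u - 3/4) * f t + (3/4 - t) * f u ≤ (u - t) * a := by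
    intro t u ht0 ht hu hu1
    have hpos : 0 < u - t := by linarith
    have := hc t u ((u-3/4)/(u-t)) ((3/4-t)/(u-t)) ht0 (by linarith) (by linarith) hu1
      (div_nonneg (by linarith) hpos.le) (div_nonneg (by linarith) hpos.le)
      (by rw [← add_div]; rw [div_eq_one_iff_eq hpos.ne']; ring)
    rw [show (u-3/4)/(u-t) * t + (3/4-t)/(u-t) * u = 3/4 by field_simp; ring] at this
    have h2 := mul_le_mul_of_nonneg_left this hpos.le
    have e : (u - t) * ((u-3/4)/(u-t) * f t + (3/4-t)/(u-t) * f u)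
      = (u - 3/4) * f t + (3/4 - t) * f u := by field_simp
    rw [e] at h2
    exact h2
  have ha00 : 0 ≤ a := h0 _
  have h4 : ∀ t : ℝ, 0 ≤ t → t < 3/4 → f t ≤ 4 * (1 - t) * a := by
    intro t ht0 ht
    by_contra hlt
    push Not at hlt
    have hd : 0 < f t - a := by nlinarith
    have hw : (3/4 * f t - t * a) / (f t - a) < 1 := by rw [div_lt_one hd]; linarith
    have hw2 : 3/4 ≤ (3/4 * f t - t * a) / (f t - a) := by rw [le_div_iff₀ hd]; nlinarith
    set w := (3/4 * f t - t * a) / (f t - a) with hwd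
    have hwe : w * (f t - a) = 3/4 * f t - t * a := by rw [hwd]; field_simp
    have := key t ((w+1)/2) ht0 ht (by linarith) (by linarith)
    have h5 := mul_nonneg (by linarith : (0:ℝ) ≤ 3/4 - t) (h0 ((w+1)/2))
    nlinarith
  have ha0 : 0 < a := by linarith [h4 0 le_rfl (by norm_num)]
  refine ⟨ha0, ?_⟩
  set S : Set ℝ := (fun t => (f t - a) / (3/4 - t)) '' Set.Ico 0 (3/4) with hS
  have hbd : ∀ v ∈ S, v ≤ 4 * a := by
    rintro _ ⟨t, ht, rfl⟩
    simp only
    rw [div_le_iff₀ (by linarith [ht.2])]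
    linarith [h4 t ht.1 ht.2]
  have hbb : BddAbove S := ⟨_, hbd⟩
  have hne : S.Nonempty := ⟨_, 0, ⟨le_rfl, by norm_num⟩, rfl⟩
  have hs4 : sSup S ≤ 4 * a := csSup_le hne hbd
  have hs0 : 0 ≤ sSup S := by
    refine le_trans ?_ (le_csSup hbb ⟨0, ⟨le_rfl, by norm_num⟩, rfl⟩)
    exact div_nonneg (by linarith [hanti 0 (3/4) le_rfl (by norm_num)]) (by norm_num)
  refine ⟨sSup S / (4 * a), by positivity, by rw [div_le_one (by positivity)]; exact hs4, ?_⟩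
  intro t ht ht1
  have e : (1 - sSup S / (4 * a)) * a + sSup S / (4 * a) * (4 * a * (1 - t))
      = a - sSup S * (t - 3/4) := by field_simp; ring
  rw [e]
  rcases lt_trichotomy t (3/4) with h | h | h
  · have := le_csSup hbb ⟨t, ⟨ht, h⟩, rfl⟩
    simp only at this
    rw [div_le_iff₀ (by linarith)] at this
    linarith
  · subst h; simp [ha]
  · have : sSup S ≤ (a - f t) / (t - 3/4) := by
      refine csSup_le hne ?_
      rintro _ ⟨r, hr, rfl⟩
      simp only
      rw [div_le_div_iff₀ (by linarith [hr.2]) (by linarith)]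
      linarith [key r t hr.1 hr.2 h ht1]
    rw [le_div_iff₀ (by linarith)] at this
    linarith

section
variable {K L : Set (EuclideanSpace ℝ (Fin n))}

def slice (K L : Set (EuclideanSpace ℝ (Fin n))) (z : EuclideanSpace ℝ (Fin n)) :
    Set (EuclideanSpace ℝ (Fin n)) := {x | x ∈ K ∧ z - x ∈ L}

theorem slice_compact (hK : IsCompact K) (hL : IsCompact L) (z) : IsCompact (slice K L z) := by
  have : slice K L z = K ∩ (fun x => z - x) ⁻¹' L := rfl
  rw [this]
  exact hK.inter_right (hL.isClosed.preimage (by fun_prop))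

theorem covar_eq (z : EuclideanSpace ℝ (Fin n)) : covar K L z = (volume (slice K L z)).toReal := rfl

theorem covar_nonneg (z : EuclideanSpace ℝ (Fin n)) : 0 ≤ covar K L z := ENNReal.toReal_nonneg

theorem slice_nonempty {z : EuclideanSpace ℝ (Fin n)} :
    (slice K L z).Nonempty ↔ z ∈ K + L := by
  constructor
  · rintro ⟨x, hx, hz⟩
    exact ⟨x, hx, z - x, hz, by simp⟩
  · rintro ⟨x, hx, y, hy, rfl⟩
    exact ⟨x, hx, by simpa using hy⟩

theorem mem_add_of_covar_pos {z : EuclideanSpace ℝ (Fin n)} (h : 0 < covar K L z) : z ∈ K + L := by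
  rw [← slice_nonempty]
  by_contra he
  rw [not_nonempty_iff_eq_empty] at he
  rw [covar_eq, he] at h
  simp at h

theorem slice_concave (hn : 0 < n) (hK : IsConvexBody K) (hL : IsConvexBody L)
    {z0 z1 : EuclideanSpace ℝ (Fin n)} (h0 : z0 ∈ K + L) (h1 : z1 ∈ K + L) {p q : ℝ}
    (hp : 0 ≤ p) (hq : 0 ≤ q) (hpq : p + q = 1) :
    p * vrad (slice K L z0) + q * vrad (slice K L z1) ≤ vrad (slice K L (p • z0 + q • z1)) := by
  refine bm hn (slice_compact hK.1 hL.1 _).measurableSet (slice_compact hK.1 hL.1 _).measurableSet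
    (slice_compact hK.1 hL.1 _).measurableSet (slice_nonempty.2 h0) (slice_nonempty.2 h1)
    (slice_compact hK.1 hL.1 _).measure_ne_top hp hq ?_
  rintro a ⟨ha, ha'⟩ b ⟨hb, hb'⟩
  refine ⟨hK.2.1 ha hb hp hq hpq, ?_⟩
  have := hL.2.1 ha' hb' hp hq hpq
  convert this using 1
  simp only [smul_sub]
  abel

theorem prodset_meas (hK : IsCompact K) (hL : IsCompact L) :
    MeasurableSet {w : EuclideanSpace ℝ (Fin n) × EuclideanSpace ℝ (Fin n) |
      w.2 ∈ K ∧ w.1 - w.2 ∈ L} :=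
  (measurable_snd hK.measurableSet).inter ((measurable_fst.sub measurable_snd) hL.measurableSet)

theorem slice_measurable (hK : IsCompact K) (hL : IsCompact L) :
    Measurable fun z => volume (slice K L z) :=
  measurable_measure_prodMk_left (prodset_meas hK hL)

theorem covar_measurable (hK : IsCompact K) (hL : IsCompact L) : Measurable (covar K L) :=
  (slice_measurable hK hL).ennreal_toReal

theorem lintegral_covar (hK : IsCompact K) (hL : IsCompact L) :
    ∫⁻ z, ENNReal.ofReal (covar K L z) = volume K * volume L := by
  have e : ∀ z, ENNReal.ofReal (covar K L z) = volume (slice K L z) := fun z =>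
    ENNReal.ofReal_toReal (slice_compact hK hL z).measure_ne_top
  simp only [e]
  have h1 := Measure.prod_apply (μ := (volume : Measure (EuclideanSpace ℝ (Fin n))))
    (ν := (volume : Measure (EuclideanSpace ℝ (Fin n)))) (prodset_meas hK hL)
  have h2 := Measure.prod_apply_symm (μ := (volume : Measure (EuclideanSpace ℝ (Fin n))))
    (ν := (volume : Measure (EuclideanSpace ℝ (Fin n)))) (prodset_meas hK hL)
  have h3 : ∫⁻ z, volume (slice K L z) = ∫⁻ x, K.indicator (fun _ => volume L) x := by
    refine (h1.symm.trans h2).trans (lintegral_congr fun x => ?_)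
    by_cases hx : x ∈ K
    · rw [indicator_of_mem hx]
      simp only [preimage_ofPred_eq, hx, true_and]
      exact (measurePreserving_sub_right volume x).measure_preimage
        hL.measurableSet.nullMeasurableSet
    · rw [indicator_of_notMem hx]
      simp [hx]
  rw [h3, lintegral_indicator_const hK.measurableSet, mul_comm]

theorem covar_le_left (hK : IsCompact K) (z) : covar K L z ≤ (volume K).toReal :=
  ENNReal.toReal_mono hK.measure_ne_top (measure_mono fun _ hx => hx.1)

theorem covar_le_right (hL : IsCompact L) (z) : covar K L z ≤ (volume L).toReal := by
  refine ENNReal.toReal_mono hL.measure_ne_top ?_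
  calc _ ≤ volume ((fun x => z - x) ⁻¹' L) := measure_mono fun _ hx => hx.2
    _ = volume L := (Measure.measurePreserving_sub_left volume z).measure_preimage
          hL.measurableSet.nullMeasurableSet

theorem covar_bdd (hK : IsCompact K) : BddAbove (range (covar K L)) :=
  ⟨_, by rintro _ ⟨z, rfl⟩; exact covar_le_left hK z⟩

theorem body_pos (hK : IsConvexBody K) : 0 < (volume K).toReal :=
  ENNReal.toReal_pos (Measure.measure_pos_of_nonempty_interior _ hK.2.2).ne' hK.1.measure_ne_top

theorem Mmax_pos (hK : IsConvexBody K) (hL : IsConvexBody L) : 0 < Mmax K L := by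
  by_contra hM
  push Not at hM
  have : ∀ z, covar K L z = 0 := fun z =>
    le_antisymm ((le_ciSup (covar_bdd hK.1) z).trans hM) (covar_nonneg z)
  have h := lintegral_covar hK.1 hL.1
  simp only [this, ENNReal.ofReal_zero, lintegral_zero] at h
  have h1 := body_pos hK
  have h2 := body_pos hL
  have := congrArg ENNReal.toReal h
  rw [ENNReal.toReal_mul] at this
  have := mul_pos h1 h2
  rw [ENNReal.toReal_zero] at *
  linarith

theorem theta_meas (hK : IsCompact K) (hL : IsCompact L) (θ : ℝ) :
    MeasurableSet (thetaConv K L θ) :=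
  (hK.add hL).measurableSet.inter (covar_measurable hK hL measurableSet_Ici)

theorem theta_fin (hK : IsCompact K) (hL : IsCompact L) (θ : ℝ) :
    volume (thetaConv K L θ) ≠ ⊤ :=
  ((measure_mono fun _ hx => hx.1).trans_lt (hK.add hL).measure_lt_top).ne

theorem theta_nonempty (hK : IsConvexBody K) (hL : IsConvexBody L) {θ : ℝ} (h0 : 0 ≤ θ)
    (h1 : θ < 1) : (thetaConv K L θ).Nonempty := by
  have hM := Mmax_pos hK hL
  have : θ * Mmax K L < ⨆ z, covar K L z := by
    change _ < Mmax K L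
    nlinarith
  obtain ⟨z, hz⟩ := exists_lt_of_lt_ciSup this
  exact ⟨z, mem_add_of_covar_pos (lt_of_le_of_lt (by positivity) hz), hz.le⟩

theorem mem_theta_iff (hn : 0 < n) (hK : IsConvexBody K) (hL : IsConvexBody L) {t : ℝ}
    (ht : 0 ≤ t) (z : EuclideanSpace ℝ (Fin n)) :
    z ∈ thetaConv K L (t ^ n) ↔
      z ∈ K + L ∧ t * Mmax K L ^ ((1:ℝ)/n) ≤ vrad (slice K L z) := by
  have hM := Mmax_pos hK hL
  refine and_congr_right fun _ => ?_
  rw [covar_eq, ← vrad_pow hn, ← pow_le_pow_iff_left₀ (by positivity) (vrad_nonneg _) hn.ne',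
    mul_pow, one_div, Real.rpow_inv_natCast_pow hM.le hn.ne']

theorem theta_concave (hn : 0 < n) (hK : IsConvexBody K) (hL : IsConvexBody L)
    (x y p q : ℝ) (hx : 0 ≤ x) (hx1 : x < 1) (hy : 0 ≤ y) (hy1 : y < 1) (hp : 0 ≤ p) (hq : 0 ≤ q)
    (hpq : p + q = 1) :
    p * vrad (thetaConv K L (x ^ n)) + q * vrad (thetaConv K L (y ^ n))
      ≤ vrad (thetaConv K L ((p * x + q * y) ^ n)) := by
  refine bm hn (theta_meas hK.1 hL.1 _) (theta_meas hK.1 hL.1 _) (theta_meas hK.1 hL.1 _)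
    (theta_nonempty hK hL (by positivity) (pow_lt_one₀ hx hx1 hn.ne'))
    (theta_nonempty hK hL (by positivity) (pow_lt_one₀ hy hy1 hn.ne'))
    (theta_fin hK.1 hL.1 _) hp hq ?_
  intro a ha b hb
  rw [mem_theta_iff hn hK hL hx] at ha
  rw [mem_theta_iff hn hK hL hy] at hb
  rw [mem_theta_iff hn hK hL (by positivity)]
  refine ⟨(hK.2.1.add hL.2.1) ha.1 hb.1 hp hq hpq, ?_⟩
  refine le_trans ?_ (slice_concave hn hK hL ha.1 hb.1 hp hq hpq)
  nlinarith [mul_le_mul_of_nonneg_left ha.2 hp, mul_le_mul_of_nonneg_left hb.2 hq]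

theorem theta_zero : thetaConv K L ((0:ℝ)) = K + L := by
  ext z
  simp only [thetaConv, zero_mul, mem_ofPred_eq, and_iff_left_iff_imp]
  exact fun _ => covar_nonneg z

theorem vrad_add_le (hn : 0 < n) (hK : IsConvexBody K) (hL : IsConvexBody L) :
    vrad K + vrad L ≤ vrad (K + L) :=
  bm_add hn hK.1.measurableSet hL.1.measurableSet (hK.1.add hL.1).measurableSet
    (hK.2.2.mono interior_subset) (hL.2.2.mono interior_subset) (hK.1.add hL.1).measure_ne_top
    fun _ ha _ hb => add_mem_add ha hb

theorem vol_prod_le (hn : 0 < n) (hK : IsConvexBody K) (hL : IsConvexBody L) {c d : ℝ}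
    (hc : 0 ≤ c) (hd : 0 ≤ d)
    (h : ∀ t, 0 ≤ t → t < 1 → vrad (thetaConv K L (t ^ n)) ^ n ≤ c + d * (1 - t) ^ n) :
    (volume K).toReal * (volume L).toReal ≤ Mmax K L * (c + d * (1 / ((2*n).choose n))) := by
  have hM := Mmax_pos hK hL
  set M := Mmax K L with hMd
  set G : ℝ → ℝ := fun θ => c + d * (1 - θ ^ ((1:ℝ)/n)) ^ n with hG
  have hrc : Continuous fun θ : ℝ => θ ^ ((1:ℝ)/n) := Real.continuous_rpow_const (by positivity)
  have hGc : Continuous G := by fun_prop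
  have hGM : Continuous fun u => G (u / M) := hGc.comp (by fun_prop)
  have hGi : ∫ θ in (0:ℝ)..1, G θ = c + d * (1 / ((2*n).choose n)) := by
    simp only [hG]
    rw [intervalIntegral.integral_add (by simp) (by apply Continuous.intervalIntegrable; fun_prop),
      intervalIntegral.integral_const_mul, beta_theta hn]
    simp
  have hGi2 : ∫ u in Ioc 0 M, G (u / M) = M * (c + d * (1 / ((2*n).choose n))) := by
    rw [← intervalIntegral.integral_of_le hM.le, intervalIntegral.integral_comp_div _ hM.ne',
      zero_div, div_self hM.ne', hGi, smul_eq_mul]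
  have root1 : ∀ u ∈ Ioc 0 M, (u / M) ^ ((1:ℝ)/n) ≤ 1 := fun u hu =>
    Real.rpow_le_one (div_nonneg hu.1.le hM.le) ((div_le_one hM).2 hu.2) (by positivity)
  have hG0 : ∀ u ∈ Ioc 0 M, 0 ≤ G (u / M) := by
    intro u hu
    have : 0 ≤ 1 - (u / M) ^ ((1:ℝ)/n) := by linarith [root1 u hu]
    simp only [hG]
    positivity
  have h1 : volume K * volume L ≤ ENNReal.ofReal (M * (c + d * (1 / ((2*n).choose n)))) := by
    rw [← hGi2, ofReal_integral_eq_lintegral_ofReal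
      ((hGM.integrableOn_Icc).mono_set Ioc_subset_Icc_self)
      ((ae_restrict_iff' measurableSet_Ioc).2 (ae_of_all _ hG0)),
      ← lintegral_covar hK.1 hL.1, lintegral_eq_lintegral_meas_le _
        (ae_of_all _ covar_nonneg) (covar_measurable hK.1 hL.1).aemeasurable,
      ← lintegral_indicator measurableSet_Ioi, ← lintegral_indicator measurableSet_Ioc]
    apply lintegral_mono_ae
    have : ∀ᵐ u : ℝ, u ≠ M := by simp [ae_iff]
    filter_upwards [this] with u huM
    by_cases hu : 0 < u
    swap
    · rw [indicator_of_notMem (by simpa using hu)]; exact zero_le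
    rw [indicator_of_mem (by exact hu)]
    rcases lt_or_gt_of_ne huM with hlt | hgt
    · rw [indicator_of_mem (show u ∈ Ioc 0 M from ⟨hu, hlt.le⟩)]
      have hq0 : 0 ≤ u / M := by positivity
      have hr0 : 0 ≤ (u / M) ^ ((1:ℝ)/n) := by positivity
      have hpow : ((u / M) ^ ((1:ℝ)/n)) ^ n = u / M := by
        rw [one_div, Real.rpow_inv_natCast_pow hq0 hn.ne']
      have hlt1 : (u / M) ^ ((1:ℝ)/n) < 1 :=
        Real.rpow_lt_one hq0 ((div_lt_one hM).2 hlt) (by positivity)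
      have hb := h _ hr0 hlt1
      rw [hpow, vrad_pow hn] at hb
      have hset : {a | u ≤ covar K L a} = thetaConv K L (u / M) := by
        ext z
        simp only [thetaConv, mem_ofPred_eq, ← hMd, div_mul_cancel₀ u hM.ne']
        exact ⟨fun hz => ⟨mem_add_of_covar_pos (hu.trans_le hz), hz⟩, fun hz => hz.2⟩
      rw [hset, ← ENNReal.ofReal_toReal (theta_fin hK.1 hL.1 (u / M))]
      exact ENNReal.ofReal_le_ofReal hb
    · have : {a | u ≤ covar K L a} = ∅ := by
        ext z
        simpa using (le_ciSup (covar_bdd hK.1) z).trans_lt hgt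
      rw [this]; simp
  rw [← ENNReal.toReal_mul]
  exact ENNReal.toReal_le_of_le_ofReal (by positivity) h1

theorem quarter_bound (hn : 0 < n) (hK : IsConvexBody K) (hL : IsConvexBody L) :
    (((2*n).choose n : ℝ)) ^ ((1:ℝ)/n) / 8 * (vrad K + vrad L)
      ≤ vrad (thetaConv K L ((3/4 : ℝ) ^ n)) := by
  have hk : 0 < vrad K := Real.rpow_pos_of_pos (body_pos hK) _
  have hl : 0 < vrad L := Real.rpow_pos_of_pos (body_pos hL) _
  have hf0 : 0 < vrad (thetaConv K L ((0:ℝ) ^ n)) := by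
    rw [zero_pow hn.ne', theta_zero]
    linarith [vrad_add_le hn hK hL]
  obtain ⟨ha, l, l0, l1, hl'⟩ := exists_lam (f := fun t => vrad (thetaConv K L (t ^ n)))
    (theta_concave hn hK hL) (fun _ => vrad_nonneg _)
    (fun x y hx hxy => vrad_mono (measure_mono fun z hz => ⟨hz.1, le_trans
      (mul_le_mul_of_nonneg_right (pow_le_pow_left₀ hx hxy n) (Mmax_pos hK hL).le) hz.2⟩)
      (theta_fin hK.1 hL.1 _)) hf0
  set a := vrad (thetaConv K L ((3/4 : ℝ) ^ n)) with had
  have hCpos : (0:ℝ) < (2*n).choose n := by exact_mod_cast Nat.choose_pos (by omega)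
  have hC4 : (((2*n).choose n : ℕ) : ℝ) ≤ 4 ^ n := by
    have := Nat.centralBinom_le_four_pow n
    rw [Nat.centralBinom_eq_two_mul_choose] at this
    exact_mod_cast this
  have hM := Mmax_pos hK hL
  have h1 := vol_prod_le hn hK hL (c := (1 - l) * a ^ n) (d := l * (4 * a) ^ n)
    (mul_nonneg (by linarith) (by positivity)) (by positivity) (by
      intro t ht ht1
      calc _ ≤ ((1 - l) * a + l * (4 * a * (1 - t))) ^ n :=
            pow_le_pow_left₀ (vrad_nonneg _) (hl' t ht ht1) n
        _ ≤ (1 - l) * a ^ n + l * (4 * a * (1 - t)) ^ n := by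
            have := (convexOn_pow (𝕜 := ℝ) n).2 (mem_Ici.2 ha.le)
              (mem_Ici.2 (mul_nonneg (by positivity) (by linarith) : 0 ≤ 4 * a * (1 - t)))
              (by linarith : 0 ≤ 1 - l) l0 (by ring)
            simpa using this
        _ = _ := by rw [mul_pow]; ring)
  have h2 : (1 - l) * a ^ n + l * (4 * a) ^ n * (1 / ((2*n).choose n)) ≤
      (4 * a) ^ n / ((2*n).choose n) := by
    have : a ^ n ≤ (4 * a) ^ n / ((2*n).choose n) := by
      rw [le_div_iff₀ hCpos, mul_pow, mul_comm]
      exact mul_le_mul_of_nonneg_right hC4 (by positivity)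
    have h3 := mul_le_mul_of_nonneg_left this (by linarith : 0 ≤ 1 - l)
    calc _ ≤ (1 - l) * ((4 * a) ^ n / ((2*n).choose n)) +
            l * (4 * a) ^ n * (1 / ((2*n).choose n)) := by linarith
      _ = _ := by ring
  have h3 := h1.trans (mul_le_mul_of_nonneg_left h2 hM.le)
  set X := (4 * a) ^ n / (((2*n).choose n : ℕ) : ℝ) with hX
  have X0 : 0 < X := by positivity
  have hML : Mmax K L ≤ (volume L).toReal := ciSup_le fun z => covar_le_right hL.1 z
  have hMK : Mmax K L ≤ (volume K).toReal := ciSup_le fun z => covar_le_left hK.1 z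
  have bK : (volume K).toReal ≤ X := by
    have := h3.trans (mul_le_mul_of_nonneg_right hML X0.le)
    rw [mul_comm] at this
    exact le_of_mul_le_mul_left this (body_pos hL)
  have bL : (volume L).toReal ≤ X := by
    have := h3.trans (mul_le_mul_of_nonneg_right hMK X0.le)
    exact le_of_mul_le_mul_left this (body_pos hK)
  set R := (((2*n).choose n : ℝ)) ^ ((1:ℝ)/n) with hR
  have R0 : 0 < R := Real.rpow_pos_of_pos hCpos _
  have hRn : R ^ n = (2*n).choose n := by
    rw [hR, one_div, Real.rpow_inv_natCast_pow hCpos.le hn.ne']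
  have hXp : X = (4 * a / R) ^ n := by rw [hX, div_pow, hRn]
  have rt : ∀ S : Set (EuclideanSpace ℝ (Fin n)), (volume S).toReal ≤ X → vrad S ≤ 4 * a / R := by
    intro S hS
    rw [← vrad_pow hn, hXp] at hS
    exact le_of_pow_le_pow_left₀ hn.ne' (by positivity) hS
  have r1 := rt K bK
  have r2 := rt L bL
  rw [le_div_iff₀ R0] at r1 r2
  nlinarith

end

theorem thetaConv_brunn_minkowski_improved_small (hn : 0 < n)
    (K L : Set (EuclideanSpace ℝ (Fin n)))
    (hK : IsConvexBody K) (hL : IsConvexBody L) (θ : ℝ)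
    (hθ0 : 0 ≤ θ) (hθ : θ ≤ ((3:ℝ)/4) ^ n) :
    (volume (thetaConv K L θ)).toReal ^ ((1:ℝ)/n) ≥
      (1 - ((4:ℝ)/3 - (1/6) * ((Nat.choose (2*n) n : ℝ)) ^ ((1:ℝ)/n)) * θ ^ ((1:ℝ)/n)) *
        ((volume K).toReal ^ ((1:ℝ)/n) + (volume L).toReal ^ ((1:ℝ)/n)) := by
  set t := θ ^ ((1:ℝ)/n) with ht
  have t0 : 0 ≤ t := by positivity
  have htn : t ^ n = θ := by rw [ht, one_div, Real.rpow_inv_natCast_pow hθ0 hn.ne']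
  have t34 : t ≤ 3/4 := by
    rw [← htn] at hθ
    exact le_of_pow_le_pow_left₀ hn.ne' (by norm_num) hθ
  have hc := theta_concave hn hK hL 0 (3/4) (1 - 4/3 * t) (4/3 * t) le_rfl one_pos (by norm_num)
    (by norm_num) (by linarith) (by positivity) (by ring)
  rw [show (1 - 4/3 * t) * 0 + 4/3 * t * (3/4) = t by ring, htn, zero_pow hn.ne', theta_zero] at hc
  have h1 := mul_le_mul_of_nonneg_left (vrad_add_le hn hK hL) (by linarith : 0 ≤ 1 - 4/3 * t)
  have h2 := mul_le_mul_of_nonneg_left (quarter_bound hn hK hL) (by positivity : 0 ≤ 4/3 * t)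
  change vrad (thetaConv K L θ) ≥ _ * (vrad K + vrad L)
  linarith
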